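/- Neutral terms and positive occurrences: let t be LO neutral and Φ ▷^(b,r) Γ ⊢ t : τ be a typing derivation in the LO type system. Then τ is a positive occurrence of Γ. -/

import Mathlib

/-! The λ-calculus, leftmost-outermost evaluation, and the LO multi type
system, with traditional and shrinking typings. -/

namespace LO

/-- λ-terms. -/
inductive Term : Type
  | var : ℕ → Term
  | lam : ℕ → Term → Term
  | app : Term → Term → Term

/-- Meta-level substitution `t{x:=u}`. -/
def subst (x : ℕ) (u : Term) : Term → Term
  | Term.var y => if y = x then u else Term.var y
  | Term.lam y t => if y = x then Term.lam y t else Term.lam y (subst x u t)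
  | Term.app t p => Term.app (subst x u t) (subst x u p)

/-- Term size: `|x| = 0`, `|λx.t| = |t| + 1`, `|t u| = |t| + |u| + 1`. -/
def size : Term → ℕ
  | Term.var _ => 0
  | Term.lam _ t => size t + 1
  | Term.app t u => size t + size u + 1

mutual
  /-- LO neutral terms: β-normal forms of the shape `x t₁ … t_k`. -/
  inductive Neutral : Term → Prop
    | var (x : ℕ) : Neutral (Term.var x)
    | app {t u : Term} : Neutral t → Normal u → Neutral (Term.app t u)

  /-- β-normal forms. -/
  inductive Normal : Term → Prop
    | neutral {t : Term} : Neutral t → Normal t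
    | lam {x : ℕ} {t : Term} : Normal t → Normal (Term.lam x t)
end

/-- Abstractions. -/
def IsAbs : Term → Prop
  | Term.lam _ _ => True
  | _ => False

/-- Leftmost-outermost evaluation `→lo`: the deterministic strategy
contracting the leftmost-outermost β-redex. -/
inductive LOStep : Term → Term → Prop
  | beta {x : ℕ} {t u : Term} : LOStep (Term.app (Term.lam x t) u) (subst x u t)
  | lam {x : ℕ} {t t' : Term} : LOStep t t' → LOStep (Term.lam x t) (Term.lam x t')
  | appL {t t' u : Term} : ¬ IsAbs t → LOStep t t' →
      LOStep (Term.app t u) (Term.app t' u)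
  | appR {t u u' : Term} : Neutral t → LOStep u u' →
      LOStep (Term.app t u) (Term.app t u')

/-- `Steps R k t u`: `t` evaluates to `u` in exactly `k` `R`-steps. -/
def Steps (R : Term → Term → Prop) : ℕ → Term → Term → Prop
  | 0, t, u => t = u
  | k + 1, t, u => ∃ p, R t p ∧ Steps R k p u

/-- Types: base type variables, the two tight constants, and arrow types whose
source is a finite multiset (represented as a list) of types. -/
inductive Ty : Type
  | base : ℕ → Ty
  | neutral : Ty
  | abs : Ty
  | arrow : List Ty → Ty → Ty

/-- A type is tight when it is one of the two tight constants. -/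
def tightTy (τ : Ty) : Prop := τ = Ty.neutral ∨ τ = Ty.abs

/-- A multiset of types is tight when all its elements are tight. -/
def tightM (M : List Ty) : Prop := ∀ τ ∈ M, tightTy τ

mutual
  /-- A type is traditional when no tight constant occurs in it. -/
  def tradTy : Ty → Bool
    | Ty.base _ => true
    | Ty.neutral => false
    | Ty.abs => false
    | Ty.arrow M τ => tradM M && tradTy τ

  def tradM : List Ty → Bool
    | [] => true
    | τ :: M => tradTy τ && tradM M
end

mutual
  /-- Type size `‖τ‖`. -/
  def tySize : Ty → ℕ
    | Ty.arrow M τ => tySizeM M + tySize τ + 1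
    | _ => 0

  /-- Size of a multiset of types. -/
  def tySizeM : List Ty → ℕ
    | [] => 0
    | τ :: M => tySize τ + tySizeM M
end

instance : Zero (List Ty) := ⟨[]⟩

/-- Typing contexts: finitely supported maps from variables to multisets of
types. -/
abbrev Ctx : Type := ℕ →₀ List Ty

/-- Multiset union of typing contexts. -/
noncomputable def Ctx.union (Γ Δ : Ctx) : Ctx := Finsupp.zipWith (· ++ ·) rfl Γ Δ

/-- Size `‖Γ‖` of a typing context: the sum of the sizes of its multisets. -/
def ctxSize (Γ : Ctx) : ℕ := Γ.sum fun _ M => tySizeM M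

/-- A typing context is tight when all its multisets are tight. -/
def tightCtx (Γ : Ctx) : Prop := ∀ x, tightM (Γ x)

/-- A (multi)type: either a type or a multiset of types. -/
abbrev TyOrM : Type := Ty ⊕ List Ty

mutual
  /-- `PosTy T τ`: the (multi)type `T` occurs positively in `τ`. -/
  inductive PosTy : TyOrM → Ty → Prop
    | self (τ : Ty) : PosTy (Sum.inl τ) τ
    | arrL {T : TyOrM} {M : List Ty} {τ : Ty} : NegM T M → PosTy T (Ty.arrow M τ)
    | arrR {T : TyOrM} {M : List Ty} {τ : Ty} : PosTy T τ → PosTy T (Ty.arrow M τ)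

  /-- `NegTy T τ`: the (multi)type `T` occurs negatively in `τ`. -/
  inductive NegTy : TyOrM → Ty → Prop
    | arrL {T : TyOrM} {M : List Ty} {τ : Ty} : PosM T M → NegTy T (Ty.arrow M τ)
    | arrR {T : TyOrM} {M : List Ty} {τ : Ty} : NegTy T τ → NegTy T (Ty.arrow M τ)

  /-- `PosM T M`: the (multi)type `T` occurs positively in the multiset `M`. -/
  inductive PosM : TyOrM → List Ty → Prop
    | self (M : List Ty) : PosM (Sum.inr M) M
    | mem {T : TyOrM} {M : List Ty} {τ : Ty} : τ ∈ M → PosTy T τ → PosM T M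

  /-- `NegM T M`: the (multi)type `T` occurs negatively in the multiset `M`. -/
  inductive NegM : TyOrM → List Ty → Prop
    | mem {T : TyOrM} {M : List Ty} {τ : Ty} : τ ∈ M → NegTy T τ → NegM T M
end

/-- `T` occurs positively in the typing context `Γ`. -/
def PosCtx (T : TyOrM) (Γ : Ctx) : Prop := ∃ x ∈ Γ.support, PosM T (Γ x)

/-- A type is shrinking when the empty multiset does not occur positively in it. -/
def shrinkTy (τ : Ty) : Prop := ¬ PosTy (Sum.inr ([] : List Ty)) τ

/-- A typing context is shrinking when the empty multiset does not occur
negatively in it. -/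
def shrinkCtx (Γ : Ctx) : Prop := ∀ x, ¬ NegM (Sum.inr ([] : List Ty)) (Γ x)

mutual
  /-- The LO type system: `Deriv Γ t τ b r s c` means that there is a typing
  derivation `Φ ▷^(b,r) Γ ⊢ t : τ` whose size (number of occurrences of the
  rules `λ_b`, `λ_r`, `@_b`, `@_r`) is `s`, and which is traditional (no tight
  type occurs in it) iff `c = true`. -/
  inductive Deriv : Ctx → Term → Ty → ℕ → ℕ → ℕ → Bool → Prop
    | ax {x : ℕ} {τ : Ty} :
        Deriv (Finsupp.single x [τ]) (Term.var x) τ 0 0 0 (tradTy τ)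
    | lamB {Γ : Ctx} {x : ℕ} {t : Term} {τ : Ty} {b r s : ℕ} {c : Bool} :
        Deriv Γ t τ b r s c →
        Deriv (Γ.erase x) (Term.lam x t) (Ty.arrow (Γ x) τ) (b + 1) r (s + 1) c
    | lamR {Γ : Ctx} {x : ℕ} {t : Term} {τ : Ty} {b r s : ℕ} {c : Bool} :
        tightM (Γ x) → tightTy τ →
        Deriv Γ t τ b r s c →
        Deriv (Γ.erase x) (Term.lam x t) Ty.abs b (r + 1) (s + 1) false
    | appB {Γ Δ : Ctx} {t u : Term} {M : List Ty} {τ : Ty} {b r s b' r' s' : ℕ}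
        {c c' : Bool} :
        Deriv Γ t (Ty.arrow M τ) b r s c →
        DerivM Δ u M b' r' s' c' →
        Deriv (Ctx.union Γ Δ) (Term.app t u) τ (b + b' + 1) (r + r') (s + s' + 1)
          (c && c')
    | appR {Γ Δ : Ctx} {t u : Term} {τ' : Ty} {b r s b' r' s' : ℕ} {c c' : Bool} :
        Deriv Γ t Ty.neutral b r s c →
        tightTy τ' →
        Deriv Δ u τ' b' r' s' c' →
        Deriv (Ctx.union Γ Δ) (Term.app t u) Ty.neutral (b + b') (r + r' + 1)
          (s + s' + 1) false

  /-- The rule `many`. -/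
  inductive DerivM : Ctx → Term → List Ty → ℕ → ℕ → ℕ → Bool → Prop
    | nil {t : Term} : DerivM 0 t [] 0 0 0 true
    | cons {Γ Δ : Ctx} {t : Term} {τ : Ty} {M : List Ty} {b r s b' r' s' : ℕ}
        {c c' : Bool} :
        Deriv Γ t τ b r s c →
        DerivM Δ t M b' r' s' c' →
        DerivM (Ctx.union Γ Δ) t (τ :: M) (b + b') (r + r') (s + s') (c && c')
end


theorem Ctx.mem_union_left {Γ : Ctx} {x : ℕ} {σ : Ty} (Δ : Ctx) (h : σ ∈ Γ x) :
    σ ∈ Ctx.union Γ Δ x := by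
  rw [Ctx.union, Finsupp.zipWith_apply]
  exact List.mem_append_left _ h

/-- The type of an LO neutral term ends some type `σ` of its typing context: whatever occurs
positively in the former occurs positively in the latter. -/
theorem Neutral.exists_mem_ctx {t : Term} (hn : Neutral t) {Γ : Ctx} {τ : Ty} {b r s : ℕ}
    {c : Bool} (Φ : Deriv Γ t τ b r s c) :
    ∃ x, ∃ σ ∈ Γ x, ∀ T, PosTy T τ → PosTy T σ := by
  induction t generalizing Γ τ b r s c with
  | var y =>
    cases Φ
    exact ⟨y, τ, by simp, fun _ h => h⟩
  | lam y t ih => cases hn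
  | app t u iht ihu =>
    cases hn with
    | app ht hu =>
      cases Φ with
      | appB Φt Φu =>
        obtain ⟨x, σ, hσ, h⟩ := iht ht Φt
        exact ⟨x, σ, Ctx.mem_union_left _ hσ, fun T hT => h T (PosTy.arrR hT)⟩
      | appR Φt hτ Φu =>
        obtain ⟨x, σ, hσ, h⟩ := iht ht Φt
        exact ⟨x, σ, Ctx.mem_union_left _ hσ, h⟩

/-- Neutral terms and positive occurrences: for an LO neutral term, the final
type is a positive occurrence of the typing context. -/
theorem neutral_positive_occurrence
    {Γ : Ctx} {t : Term} {τ : Ty} {b r s : ℕ} {c : Bool}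
    (hn : Neutral t) (Φ : Deriv Γ t τ b r s c) :
    PosCtx (Sum.inl τ) Γ := by
  obtain ⟨x, σ, hσ, h⟩ := hn.exists_mem_ctx Φ
  refine ⟨x, Finsupp.mem_support_iff.mpr fun h0 => ?_, PosM.mem hσ (h _ (PosTy.self τ))⟩
  rw [h0] at hσ
  exact List.not_mem_nil hσ

end LO
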